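/- arXiv:math/0701399 — 2 statements merged into one kernel-verified Lean document; each statement's English description precedes it below -/
import Mathlib

section
/- Let g be a finite-dimensional semisimple Lie algebra over a field k of characteristic 0 and (g,A) a compatible pair (g realized as a Lie subalgebra of a unital associative k-algebra A). Then for every k ≥ 2 one has the decomposition g^k = [g, g^k] + Z_k(g) with [g, g^k] ∩ Z_k(g) = {0}, where Z_k(g) = Z(⟨g⟩) ∩ g^k, ⟨g⟩ = Σ_{n≥1} g^n is the associative subalgebra of A generated by g, and Z(⟨g⟩) is its center. -/
open Submodule TensorProduct

variable (K : Type*) [Field K]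

/-- The span of all products `a * b`, `a ∈ S`, `b ∈ T` (the subspace `S·T`). -/
def pSpan {R : Type*} [NonUnitalRing R] [Module K R] (S T : Submodule K R) : Submodule K R :=
  Submodule.span K {x | ∃ a ∈ S, ∃ b ∈ T, x = a * b}

/-- The span of all commutators `a * b - b * a`, `a ∈ S`, `b ∈ T` (the subspace `[S, T]`). -/
def bSpan {R : Type*} [NonUnitalRing R] [Module K R] (S T : Submodule K R) : Submodule K R :=
  Submodule.span K {x | ∃ a ∈ S, ∃ b ∈ T, x = a * b - b * a}

/-- The `k`-th commutator space `S^(k)`: `S^(0) = S`, `S^(k) = [S, S^(k-1)]`.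
For `S = ⊤` this is the commutator space `F^(k)` of the algebra. -/
def cSp {R : Type*} [NonUnitalRing R] [Module K R] (S : Submodule K R) : ℕ → Submodule K R
  | 0 => S
  | (k+1) => bSpan K S (cSp S k)

/-- `IklS K S ℓ k` is `I_k^ℓ(R, S)`: the sum of `S^(λ₁) ⋯ S^(λ_ℓ)` over
`λ₁ + ⋯ + λ_ℓ = k`, defined via the recursion `I_k^1 = S^(k)`,
`I_k^ℓ = Σ_{0 ≤ i ≤ k} S^(i) · I_{k-i}^{ℓ-1}`.  The first argument is the
superscript `ℓ`, the second the subscript `k`; the (unused) value at `ℓ = 0` is `⊥`.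
For `S = ⊤` this is `I_k^ℓ(F)`. -/
def IklS {R : Type*} [NonUnitalRing R] [Module K R] (S : Submodule K R) :
    ℕ → ℕ → Submodule K R
  | 0, _ => ⊥
  | 1, k => cSp K S k
  | (ℓ+2), k => ∑ i ∈ Finset.range (k+1), pSpan K (cSp K S i) (IklS S (ℓ+1) (k-i))

/-- `I_k^{≤ℓ}(F) = Σ_{1 ≤ ℓ' ≤ ℓ} I_k^{ℓ'}(F)`. -/
def Ikle {R : Type*} [NonUnitalRing R] [Module K R] (ℓ k : ℕ) : Submodule K R :=
  ∑ ℓ' ∈ Finset.Icc 1 ℓ, IklS K (⊤ : Submodule K R) ℓ' k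

/-- `I_k(F) = Σ_{ℓ ≥ 1} I_k^ℓ(F)`. -/
def Ik (R : Type*) [NonUnitalRing R] [Module K R] (k : ℕ) : Submodule K R :=
  ⨆ ℓ : ℕ, IklS K (⊤ : Submodule K R) (ℓ + 1) k

/-- `g^n`: the span of all products of `n` elements of `g` (set to `⊥` for `n = 0`). -/
def gPow {R : Type*} [NonUnitalRing R] [Module K R] (g : Submodule K R) : ℕ → Submodule K R
  | 0 => ⊥
  | 1 => g
  | (n+2) => pSpan K g (gPow g (n+1))

/-- The Lie subalgebra (under the commutator bracket) generated by a subspace `S`: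
the smallest subspace containing `S` and closed under `(x, y) ↦ x * y - y * x`. -/
def lieGen {R : Type*} [NonUnitalRing R] [Module K R] (S : Submodule K R) : Submodule K R :=
  sInf {T | S ≤ T ∧ ∀ x ∈ T, ∀ y ∈ T, x * y - y * x ∈ T}

/-- The subspace `S ⊗ T` of `F ⊗[K] A`: the span of all pure tensors `f ⊗ a`
with `f ∈ S`, `a ∈ T`. -/
def tSpan {F A : Type*} [AddCommGroup F] [Module K F] [AddCommGroup A] [Module K A]
    (S : Submodule K F) (T : Submodule K A) : Submodule K (F ⊗[K] A) :=
  Submodule.span K {z | ∃ f ∈ S, ∃ a ∈ T, z = f ⊗ₜ[K] a}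

/-- The current Lie algebra `(g, A)(F)`: the Lie subalgebra of `F ⊗ A` (with the
commutator bracket) generated by `F ⊗ g`. -/
def currentLie {F A : Type*} [NonUnitalRing F] [Module K F] [SMulCommClass K F F]
    [IsScalarTower K F F] [Ring A] [Algebra K A] (g : Submodule K A) :
    Submodule K (F ⊗[K] A) :=
  lieGen K (tSpan K (⊤ : Submodule K F) g)

attribute [local instance 100] LieRing.ofAssociativeRing

open LieAlgebra Module in
/-- A Lie algebra with a faithful finite-dimensional representation of vanishing trace form is
solvable. -/
theorem LieModule.isSolvable_of_traceForm_eq_zero {K L V : Type*} [Field K] [CharZero K]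
    [LieRing L] [LieAlgebra K L] [FiniteDimensional K L]
    [AddCommGroup V] [Module K V] [LieRingModule L V] [LieModule K L V] [FiniteDimensional K V]
    [LieModule.IsFaithful K L V] (h : LieModule.traceForm K L V = 0) :
    IsSolvable L := by
  have hnil := LieModule.isNilpotent_derivedSeries_of_traceForm_eq_zero h
  rw [LieModule.isNilpotent_iff_forall' (R := K)] at hnil
  set D : LieIdeal K L := derivedSeries K L 1
  have hDnil : LieRing.IsNilpotent D := by
    have hrange : LieRing.IsNilpotent (LieModule.toEnd K D V).range := by
      rw [LieAlgebra.isNilpotent_iff_forall (R := K)]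
      rintro ⟨_, y, rfl⟩
      exact LieAlgebra.isNilpotent_ad_of_isNilpotent (hnil y)
    refine Function.Injective.lieAlgebra_isNilpotent
      (f := (LieModule.toEnd K D V).rangeRestrict) fun x y hxy ↦ Subtype.ext ?_
    refine LieModule.ext_of_isFaithful (R := K) V fun m ↦ ?_
    exact LinearMap.congr_fun (congrArg Subtype.val hxy) m
  obtain ⟨k, hk⟩ := IsSolvable.solvable K D
  rw [LieIdeal.derivedSeries_eq_bot_iff] at hk
  refine IsSolvable.mk (R := K) (k := k + 1) ?_
  rw [derivedSeries_def, derivedSeriesOfIdeal_add]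
  exact hk

namespace LieAlgebra

/-- In a Lie algebra with trivial radical, an ideal and its Killing orthogonal are complementary. -/
theorem isCompl_killingCompl {K L : Type*} [Field K] [CharZero K]
    [LieRing L] [LieAlgebra K L] [FiniteDimensional K L] [HasTrivialRadical K L]
    (I : LieIdeal K L) : IsCompl I I.killingCompl := by
  have hdisj : Disjoint I I.killingCompl := by
    rw [disjoint_iff]
    have : IsSolvable (I ⊓ I.killingCompl : LieIdeal K L) := by
      refine LieIdeal.isSolvable_of_killingForm_apply_lie_eq_zero _ fun x hx y hy ↦ ?_
      have hy' := LieSubmodule.lie_le_right _ _ hy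
      exact (LieIdeal.mem_killingCompl K L I).mp hy'.2 x hx.1
    exact HasTrivialRadical.eq_bot_of_isSolvable _
  rw [← LieSubmodule.isCompl_toSubmodule, LieIdeal.toSubmodule_killingCompl,
    LinearMap.BilinForm.isCompl_orthogonal_iff_disjoint (LieModule.traceForm_isSymm K L L).isRefl,
    ← LieIdeal.toSubmodule_killingCompl, LieSubmodule.disjoint_toSubmodule]
  exact hdisj

variable {K L V : Type*} [Field K] [CharZero K]
    [LieRing L] [LieAlgebra K L] [FiniteDimensional K L] [HasTrivialRadical K L]
    [AddCommGroup V] [Module K V] [LieRingModule L V] [LieModule K L V] [FiniteDimensional K V]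

variable (K L V) in
/-- The trace form of a representation is nondegenerate on the Killing orthogonal of the kernel. -/
theorem traceForm_restrict_killingCompl_ker_nondegenerate :
    ((LieModule.traceForm K L V).restrict
      (LieModule.ker K L V).killingCompl.toSubmodule).Nondegenerate := by
  set B := LieModule.traceForm K L V with hB
  set J := (LieModule.ker K L V).killingCompl
  have hcompl : IsCompl (LieModule.ker K L V) J := isCompl_killingCompl _
  let S : LieIdeal K L :=
    InvariantForm.orthogonal B (LieModule.traceForm_lieInvariant K L V) ⊤
  have hmemS (x : L) : x ∈ S ↔ ∀ y, B y x = 0 := by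
    simp [S, InvariantForm.mem_orthogonal]
  have hSJ : S ⊓ J = ⊥ := by
    have : LieModule.IsFaithful K (S ⊓ J : LieIdeal K L) V := by
      rw [LieModule.isFaithful_iff']
      rintro ⟨x, hxS, hxJ⟩ hx
      have hxker : x ∈ LieModule.ker K L V := (LieModule.mem_ker K L V x).mpr hx
      exact Subtype.ext (hcompl.disjoint.le_bot ⟨hxker, hxJ⟩)
    have : IsSolvable (S ⊓ J : LieIdeal K L) := by
      refine LieModule.isSolvable_of_traceForm_eq_zero (K := K) (V := V) ?_
      ext x ⟨y, hyS, _⟩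
      exact (hmemS y).mp hyS x
    exact HasTrivialRadical.eq_bot_of_isSolvable _
  have hsymm : (B.restrict J.toSubmodule).IsSymm :=
    ⟨fun x y ↦ LieModule.traceForm_comm K L V x y⟩
  refine hsymm.isRefl.nondegenerate_iff_separatingLeft.mpr ?_
  rintro ⟨x, hx⟩ hxJ
  have hxS : x ∈ S := by
    rw [hmemS]
    intro y
    obtain ⟨a, ha, b, hb, rfl⟩ : ∃ a ∈ LieModule.ker K L V, ∃ b ∈ J, a + b = y := by
      rw [← LieSubmodule.mem_sup, hcompl.sup_eq_top]
      trivial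
    have h₁ : B a x = 0 := by
      have : LieModule.toEnd K L V a = 0 := ha
      rw [hB, LieModule.traceForm_apply_apply, this, LinearMap.zero_comp, map_zero]
    rw [map_add, LinearMap.add_apply, h₁, zero_add, hB, LieModule.traceForm_comm]
    exact hxJ ⟨b, hb⟩
  have : x ∈ S ⊓ J := ⟨hxS, hx⟩
  rw [hSJ] at this
  exact Subtype.ext this

open Module in
/-- A nontrivial finite-dimensional representation of a Lie algebra with trivial radical has an
equivariant endomorphism of nonzero trace of the form `∑ φ (b i) ∘ φ (d i)`
(a Casimir operator). -/
theorem exists_casimir (h : ¬ LieModule.IsTrivial L V) :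
    ∃ (ι : Type) (_ : Fintype ι) (b d : ι → L),
      let C : End K V := ∑ i, LieModule.toEnd K L V (b i) * LieModule.toEnd K L V (d i)
      LinearMap.trace K V C ≠ 0 ∧ ∀ x, Commute C (LieModule.toEnd K L V x) := by
  classical
  set J := (LieModule.ker K L V).killingCompl
  have hcompl : IsCompl (LieModule.ker K L V) J := isCompl_killingCompl _
  set B := (LieModule.traceForm K L V).restrict J.toSubmodule
  have hnd : B.Nondegenerate := traceForm_restrict_killingCompl_ker_nondegenerate K L V
  have hsymm : B.IsSymm := ⟨fun x y ↦ LieModule.traceForm_comm K L V x y⟩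
  let b := Module.finBasis K J.toSubmodule
  let d := B.dualBasis hnd b
  have hd (y : J.toSubmodule) : (y : L) = ∑ i, B y (b i) • (d i : L) := by
    conv_lhs => rw [← d.sum_repr y]
    simp [d, LinearMap.BilinForm.dualBasis_repr_apply]
  have hb (y : J.toSubmodule) : (y : L) = ∑ i, B y (d i) • (b i : L) := by
    have hdd : B.dualBasis hnd d = b := LinearMap.BilinForm.dualBasis_dualBasis hnd hsymm b
    conv_lhs => rw [← b.sum_repr y]
    have hrepr (i) : b.repr y i = B y (d i) := by
      rw [← hdd, LinearMap.BilinForm.dualBasis_repr_apply]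
    simp [hrepr]
  refine ⟨_, inferInstance, fun i ↦ b i, fun i ↦ d i, ?_, fun x ↦ ?_⟩
  · have hbd (i) : LinearMap.trace K V
        (LieModule.toEnd K L V (b i) * LieModule.toEnd K L V (d i)) = 1 := by
      have := LinearMap.BilinForm.apply_dualBasis_right hnd hsymm b i i
      rw [if_pos rfl] at this
      exact this
    rw [map_sum, Finset.sum_congr rfl fun i _ ↦ hbd i]
    simp only [Finset.sum_const, Finset.card_univ, Fintype.card_fin, nsmul_eq_mul, mul_one]
    rw [Nat.cast_ne_zero]
    intro h0
    apply h
    have hJ0 : J = ⊥ := by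
      rw [← LieSubmodule.toSubmodule_eq_bot]
      exact Submodule.finrank_eq_zero.mp h0
    have hker : LieModule.ker K L V = ⊤ := by simpa [hJ0] using hcompl.sup_eq_top
    refine ⟨fun y m ↦ ?_⟩
    have : y ∈ LieModule.ker K L V := hker ▸ LieSubmodule.mem_top y
    exact (LieModule.mem_ker K L V y).mp this m
  · let xb (i) : J.toSubmodule := ⟨⁅x, (b i : L)⁆, J.lie_mem (b i).2⟩
    let xd (i) : J.toSubmodule := ⟨⁅x, (d i : L)⁆, J.lie_mem (d i).2⟩
    have hinv (i j) : B (xd j) (b i) = - B (xb i) (d j) := by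
      have := LieModule.traceForm_lieInvariant K L V x (d j) (b i)
      rw [LieModule.traceForm_comm K L V (d j)] at this
      exact this
    let φ := LieModule.toEnd K L V
    have h₁ (i) : φ ⁅x, (b i : L)⁆ = ∑ j, B (xb i) (d j) • φ (b j) := by
      simp only [← map_smul, ← map_sum, ← hb (xb i), xb]
    have h₂ (i) : φ ⁅x, (d i : L)⁆ = ∑ j, B (xd i) (b j) • φ (d j) := by
      simp only [← map_smul, ← map_sum, ← hd (xd i), xd]
    have hsum : ∑ i, (φ ⁅x, (b i : L)⁆ * φ (d i) + φ (b i) * φ ⁅x, (d i : L)⁆) = 0 := by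
      simp only [h₁, h₂, Finset.sum_add_distrib, Finset.sum_mul, Finset.mul_sum, hinv,
        smul_mul_assoc, mul_smul_comm, neg_smul, mul_neg, Finset.sum_neg_distrib]
      rw [Finset.sum_comm, add_neg_cancel]
    symm
    rw [commute_iff_eq, ← sub_eq_zero, Finset.mul_sum, Finset.sum_mul, ← Finset.sum_sub_distrib,
      ← hsum]
    refine Finset.sum_congr rfl fun i _ ↦ ?_
    simp only [LieHom.map_lie, LieRing.of_associative_ring_bracket, φ]
    noncomm_ring

open Module Filter in
variable (K L V) in
/-- A finite-dimensional representation `V` of a Lie algebra `L` with trivial radical is the direct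
sum of `⁅L, V⁆` and the subspace of invariants. -/
theorem isCompl_lie_top_maxTrivSubmodule :
    IsCompl ⁅(⊤ : LieIdeal K L), (⊤ : LieSubmodule K L V)⁆ (LieModule.maxTrivSubmodule K L V) := by
  induction hn : finrank K V using Nat.strong_induction_on generalizing V with
  | _ n ih =>
  by_cases htriv : LieModule.IsTrivial L V
  · have hmax := (LieModule.isTrivial_iff_max_triv_eq_top K L V).mp htriv
    rw [hmax]
    have : ⁅(⊤ : LieIdeal K L), (⊤ : LieSubmodule K L V)⁆ = ⊥ := by
      rw [← hmax, LieModule.ideal_oper_maxTrivSubmodule_eq_bot]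
    rw [this]
    exact isCompl_bot_top
  obtain ⟨ι, _, b, d, htr, hcomm⟩ := exists_casimir (K := K) htriv
  set C : End K V := ∑ i, LieModule.toEnd K L V (b i) * LieModule.toEnd K L V (d i) with hC
  have hC_apply (v : V) : C v = ∑ i, ⁅b i, ⁅d i, v⁆⁆ := by simp [hC]
  have hCnil : ¬ IsNilpotent C := fun hnil ↦
    htr (LinearMap.isNilpotent_trace_of_isNilpotent hnil).eq_zero
  obtain ⟨m, hm, hm1⟩ :=
    (C.eventually_isCompl_ker_pow_range_pow.and (eventually_ge_atTop 1)).exists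
  obtain ⟨m, rfl⟩ := Nat.exists_eq_add_of_le' hm1
  let D : V →ₗ⁅K,L⁆ V :=
    { C ^ (m + 1) with
      map_lie' := fun {x v} ↦ LinearMap.congr_fun ((hcomm x).pow_left (m + 1)) v }
  have hD (v : V) : D v = C ((C ^ m) v) := by
    change (C ^ (m + 1)) v = _
    rw [pow_succ']; rfl
  have hD' (v : V) : D v = (C ^ m) (C v) := by
    change (C ^ (m + 1)) v = _
    rw [pow_succ]; rfl
  have hDcompl : IsCompl D.ker D.range := by
    rw [← LieSubmodule.isCompl_toSubmodule]
    exact hm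
  have hrange : D.range ≤ ⁅(⊤ : LieIdeal K L), (⊤ : LieSubmodule K L V)⁆ := by
    intro w hw
    obtain ⟨v, rfl⟩ := (LieModuleHom.mem_range D w).mp hw
    rw [hD, hC_apply]
    exact sum_mem fun i _ ↦
      LieSubmodule.lie_mem_lie (LieSubmodule.mem_top _) (LieSubmodule.mem_top _)
  have hinv (v : V) (hv : v ∈ LieModule.maxTrivSubmodule K L V) : v ∈ D.ker := by
    rw [LieModuleHom.mem_ker, hD', hC_apply]
    simp [(LieModule.mem_maxTrivSubmodule K L V v).mp hv]
  have hlt : finrank K D.ker < n := by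
    rw [← hn]
    refine Submodule.finrank_lt fun htop ↦ hCnil ⟨m + 1, LinearMap.ker_eq_top.mp htop⟩
  have hrec := ih _ hlt D.ker rfl
  have hmap : (⁅(⊤ : LieIdeal K L), (⊤ : LieSubmodule K L D.ker)⁆).map D.ker.incl =
      ⁅(⊤ : LieIdeal K L), D.ker⁆ := by
    rw [LieSubmodule.map_bracket_eq, LieSubmodule.map_incl_top]
  constructor
  · rw [disjoint_iff, eq_bot_iff]
    rintro v ⟨hv, hvinv⟩
    have hv' : v ∈ ⁅(⊤ : LieIdeal K L), D.ker⁆ := by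
      rw [← hDcompl.sup_eq_top, LieSubmodule.lie_sup] at hv
      obtain ⟨a, ha, c, hc, rfl⟩ := (LieSubmodule.mem_sup _ _ _).mp hv
      have hak : a ∈ D.ker := LieSubmodule.lie_le_right _ _ ha
      have hck : c ∈ D.ker := by simpa using sub_mem (hinv _ hvinv) hak
      have hcr : c ∈ D.range := LieSubmodule.lie_le_right _ _ hc
      have hc0 : c = 0 := by
        have := (LieSubmodule.mem_inf _ _ _).mpr ⟨hck, hcr⟩
        rwa [hDcompl.disjoint.eq_bot, LieSubmodule.mem_bot] at this
      simpa [hc0] using ha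
    rw [← hmap, LieSubmodule.mem_map] at hv'
    obtain ⟨w, hw, rfl⟩ := hv'
    have hw0 : w = 0 := by
      have hwinv : w ∈ LieModule.maxTrivSubmodule K L D.ker :=
        (LieModule.mem_maxTrivSubmodule K L _ w).mpr fun x ↦
          Subtype.ext ((LieModule.mem_maxTrivSubmodule K L V _).mp hvinv x)
      have := (LieSubmodule.mem_inf _ _ _).mpr ⟨hw, hwinv⟩
      rwa [hrec.disjoint.eq_bot, LieSubmodule.mem_bot] at this
    simp [hw0]
  · rw [codisjoint_iff, eq_top_iff]
    refine hDcompl.sup_eq_top.ge.trans (sup_le ?_ (hrange.trans le_sup_left))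
    calc D.ker = (⊤ : LieSubmodule K L D.ker).map D.ker.incl := by
          rw [LieSubmodule.map_incl_top]
      _ ≤ _ := by
        rw [← hrec.sup_eq_top, LieSubmodule.map_sup, hmap]
        refine sup_le_sup (LieSubmodule.mono_lie_right _ le_top) ?_
        rw [LieSubmodule.map_le_iff_le_comap]
        exact fun w hw x ↦ congrArg Subtype.val ((LieModule.mem_maxTrivSubmodule K L _ w).mp hw x)

end LieAlgebra

section gPow

variable {K : Type*} [Field K] {A : Type*} [Ring A] [Algebra K A]

theorem pSpan_eq_mul (S T : Submodule K A) : pSpan K S T = S * T := by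
  rw [pSpan, Submodule.mul_eq_span_mul_set]
  congr 1
  ext x
  simp only [Set.mem_ofPred_eq, Set.mem_mul, SetLike.mem_coe, eq_comm]

theorem gPow_succ_eq_pow (g : Submodule K A) (n : ℕ) : gPow K g (n + 1) = g ^ (n + 1) := by
  induction n with
  | zero => simp [gPow]
  | succ n ih => rw [gPow, pSpan_eq_mul, ih, ← pow_succ']

/-- The powers of a Lie subalgebra of an associative algebra are stable under the bracket. -/
theorem lie_mem_pow (L : LieSubalgebra K A) (n : ℕ) {x v : A} (hx : x ∈ L)
    (hv : v ∈ L.toSubmodule ^ n) : x * v - v * x ∈ L.toSubmodule ^ n := by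
  induction n generalizing v with
  | zero =>
    rw [pow_zero, Submodule.mem_one] at hv
    obtain ⟨c, rfl⟩ := hv
    rw [Algebra.commutes, sub_self]
    exact zero_mem _
  | succ n ih =>
    rw [pow_succ'] at hv ⊢
    induction hv using Submodule.mul_induction_on' with
    | mem_mul_mem a ha c hc =>
      have : x * (a * c) - a * c * x = (x * a - a * x) * c + a * (x * c - c * x) := by noncomm_ring
      rw [this]
      exact add_mem (Submodule.mul_mem_mul (L.lie_mem hx ha) hc) (Submodule.mul_mem_mul ha (ih hc))
    | add a _ c _ ha hc =>
      have : x * (a + c) - (a + c) * x = (x * a - a * x) + (x * c - c * x) := by noncomm_ring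
      rw [this]
      exact add_mem ha hc

/-- An element commuting with a subspace commutes with all of its powers. -/
theorem commute_of_mem_pow {S : Submodule K A} {v : A} (hv : ∀ y ∈ S, Commute v y) (n : ℕ)
    {y : A} (hy : y ∈ S ^ n) : Commute v y := by
  induction n generalizing y with
  | zero =>
    obtain ⟨c, rfl⟩ := Submodule.mem_one.mp (pow_zero S ▸ hy)
    exact Algebra.commute_algebraMap_right c v
  | succ n ih =>
    rw [pow_succ'] at hy
    induction hy using Submodule.mul_induction_on' with
    | mem_mul_mem a ha c hc => exact (hv a ha).mul_right (ih hc)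
    | add a _ c _ ha hc => exact ha.add_right hc

end gPow

/-- if `g ⊆ A` is a finite-dimensional semisimple Lie subalgebra, then for
`k ≥ 2` one has `g^k = [g, g^k] ⊕ Z_k(g)`, where `Z_k(g) = Z(⟨g⟩) ∩ g^k` and
`Z(⟨g⟩)` is the center of the associative subalgebra `⟨g⟩ = Σ_{n ≥ 1} g^n`. -/
theorem statement15 {K : Type*} [Field K] [CharZero K]
    {A : Type*} [Ring A] [Algebra K A]
    (L : LieSubalgebra K A) [FiniteDimensional K L] [LieAlgebra.IsSemisimple K L]
    (Z : Submodule K A)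
    (hZ : ∀ x : A, x ∈ Z ↔ x ∈ (⨆ n : ℕ, gPow K L.toSubmodule (n + 1)) ∧
      ∀ y ∈ (⨆ n : ℕ, gPow K L.toSubmodule (n + 1)), x * y = y * x)
    (k : ℕ) (hk : 2 ≤ k) :
    bSpan K L.toSubmodule (gPow K L.toSubmodule k) ⊔ (Z ⊓ gPow K L.toSubmodule k) =
      gPow K L.toSubmodule k ∧
    bSpan K L.toSubmodule (gPow K L.toSubmodule k) ⊓ (Z ⊓ gPow K L.toSubmodule k) = ⊥ := by
  obtain ⟨k, rfl⟩ : ∃ n, k = n + 1 := ⟨k - 1, by omega⟩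
  let N : LieSubmodule K L A :=
    { L.toSubmodule ^ (k + 1) with lie_mem := fun {x _} hv ↦ lie_mem_pow L (k + 1) x.2 hv }
  have hN : gPow K L.toSubmodule (k + 1) = N.toSubmodule := gPow_succ_eq_pow _ _
  have : FiniteDimensional K N :=
    Module.Finite.iff_fg.mpr (((Module.Finite.iff_fg (N := L.toSubmodule)).mp ‹_›).pow (k + 1))
  have hcompl := LieAlgebra.isCompl_lie_top_maxTrivSubmodule K L N
  have hb : bSpan K L.toSubmodule N.toSubmodule =
      ((⁅(⊤ : LieIdeal K L), (⊤ : LieSubmodule K L N)⁆).map N.incl).toSubmodule := by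
    rw [LieSubmodule.map_bracket_eq, LieSubmodule.map_incl_top,
      LieSubmodule.lieIdeal_oper_eq_linear_span', bSpan]
    congr 1
    ext v
    constructor
    · rintro ⟨x, hx, w, hw, rfl⟩
      exact ⟨⟨x, hx⟩, trivial, w, hw, rfl⟩
    · rintro ⟨x, -, w, hw, rfl⟩
      exact ⟨x, x.2, w, hw, rfl⟩
  have hz : Z ⊓ N.toSubmodule =
      ((LieModule.maxTrivSubmodule K L N).map N.incl).toSubmodule := by
    have hle (n : ℕ) : gPow K L.toSubmodule (n + 1) ≤ ⨆ n : ℕ, gPow K L.toSubmodule (n + 1) :=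
      le_iSup (fun n : ℕ ↦ gPow K L.toSubmodule (n + 1)) n
    ext v
    constructor
    · rintro ⟨hvZ, hvN⟩
      refine ⟨⟨v, hvN⟩, fun x ↦ Subtype.ext ?_, rfl⟩
      exact sub_eq_zero.mpr (((hZ v).mp hvZ).2 x (hle 0 x.2)).symm
    · rintro ⟨w, hw, rfl⟩
      refine ⟨(hZ _).mpr ⟨hle k (hN ▸ w.2), fun y hy ↦ ?_⟩, w.2⟩
      have hcomm : ∀ y ∈ L.toSubmodule, Commute (w : A) y := fun y hy ↦
        (sub_eq_zero.mp (congrArg Subtype.val (hw ⟨y, hy⟩))).symm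
      induction hy using Submodule.iSup_induction' with
      | mem n y hy => exact commute_of_mem_pow hcomm (n + 1) (gPow_succ_eq_pow L.toSubmodule n ▸ hy)
      | zero => simp
      | add a b _ _ ha hb => rw [mul_add, add_mul, ha, hb]
  rw [hN, hb, hz]
  constructor
  · rw [← LieSubmodule.sup_toSubmodule, ← LieSubmodule.map_sup, hcompl.sup_eq_top,
      LieSubmodule.map_incl_top]
  · rw [← LieSubmodule.inf_toSubmodule, LieSubmodule.toSubmodule_eq_bot, eq_bot_iff]
    rintro v ⟨⟨a, ha, rfl⟩, ⟨c, hc, hac⟩⟩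
    obtain rfl : c = a := Subtype.ext hac
    have : c = 0 := hcompl.disjoint.le_bot ⟨ha, hc⟩
    simp [this]
end

section
/- Let k be a field of characteristic 0, m ≥ 1, n = m+1, and let e = Σ_{i=1}^{m} i·E_{i,i+1}, f = Σ_{i=1}^{m} (m+1−i)·E_{i+1,i}, h = Σ_{i=1}^{n} (m+2−2i)·E_{ii} in A = M_n(k) (the images of the standard sl₂-triple under the irreducible n-dimensional representation of sl₂(k)), and let g = span{e,h,f}, a Lie subalgebra of A. For 1 ≤ j ≤ m let V_{2j} ⊆ A be the span of the matrices (ad f)^r(e^j) for 0 ≤ r ≤ 2j. Then for every associative k-algebra F one has (g,A)(F) = [F,F] ⊗ 1 + Σ_{j=1}^{m} I_{j−1}(F) ⊗ V_{2j}. -/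
open Submodule TensorProduct

variable (K : Type*) [Field K]

/-- The image of the standard generator `E` of `sl₂(k)` in the irreducible
`(m+1)`-dimensional representation: `e = Σ_{i=1}^{m} i·E_{i,i+1}`. -/
def eMat (K : Type*) [Field K] (m : ℕ) : Matrix (Fin (m + 1)) (Fin (m + 1)) K :=
  ∑ i : Fin m, Matrix.single i.castSucc i.succ (((i : ℕ) + 1 : ℕ) : K)

/-- `f = Σ_{i=1}^{m} (m+1−i)·E_{i+1,i}`. -/
def fMat (K : Type*) [Field K] (m : ℕ) : Matrix (Fin (m + 1)) (Fin (m + 1)) K :=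
  ∑ i : Fin m, Matrix.single i.succ i.castSucc ((m - (i : ℕ) : ℕ) : K)

/-- `h = Σ_{i=1}^{m+1} (m+2−2i)·E_{ii}`. -/
def hMat (K : Type*) [Field K] (m : ℕ) : Matrix (Fin (m + 1)) (Fin (m + 1)) K :=
  ∑ j : Fin (m + 1), Matrix.single j j ((m : K) - 2 * ((j : ℕ) : K))

/-- `V_{2j}`: the span of the matrices `(ad f)^r (e^j)`, `0 ≤ r ≤ 2j`. -/
def V2 (K : Type*) [Field K] (m j : ℕ) : Submodule K (Matrix (Fin (m + 1)) (Fin (m + 1)) K) :=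
  Submodule.span K {x | ∃ r : ℕ, r ≤ 2 * j ∧
    x = (fun y => fMat K m * y - y * fMat K m)^[r] ((eMat K m) ^ j)}

section CommutatorIdeals

variable {K}
variable {R : Type*} [NonUnitalRing R] [Module K R]

lemma mul_sub_mul_mem_cSp_succ {S : Submodule K R} {k : ℕ} {a x : R} (ha : a ∈ S)
    (hx : x ∈ cSp K S k) : a * x - x * a ∈ cSp K S (k + 1) :=
  subset_span ⟨a, ha, x, hx, rfl⟩

lemma cSp_succ_le {S : Submodule K R} {k : ℕ} {P : Submodule K R}
    (h : ∀ a ∈ S, ∀ x ∈ cSp K S k, a * x - x * a ∈ P) : cSp K S (k + 1) ≤ P := by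
  refine span_le.2 ?_
  rintro _ ⟨a, ha, x, hx, rfl⟩
  exact h a ha x hx

lemma cSp_top_antitone : Antitone (cSp K (⊤ : Submodule K R)) := by
  refine antitone_nat_of_succ_le fun k => ?_
  induction k with
  | zero => exact le_top
  | succ k ih => exact cSp_succ_le fun a ha x hx => mul_sub_mul_mem_cSp_succ ha (ih hx)

lemma mul_mem_IklS {S : Submodule K R} {l i j k : ℕ} (hk : i + j = k) {x y : R}
    (hx : x ∈ cSp K S i) (hy : y ∈ IklS K S (l + 1) j) : x * y ∈ IklS K S (l + 2) k := by
  have hi : i ∈ Finset.range (k + 1) := by simp; omega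
  obtain rfl : j = k - i := by omega
  have h : pSpan K (cSp K S i) (IklS K S (l + 1) (k - i)) ≤ IklS K S (l + 2) k := by
    rw [IklS]
    exact Finset.single_le_sum (f := fun i => pSpan K (cSp K S i) (IklS K S (l + 1) (k - i)))
      (fun _ _ => bot_le) hi
  exact h (subset_span ⟨x, hx, y, hy, rfl⟩)

lemma IklS_succ_le {S : Submodule K R} {l k : ℕ} {P : Submodule K R}
    (h : ∀ i j, i + j = k → ∀ x ∈ cSp K S i, ∀ y ∈ IklS K S (l + 1) j, x * y ∈ P) :
    IklS K S (l + 2) k ≤ P := by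
  rw [IklS]
  refine Finset.sum_induction _ (· ≤ P) (fun _ _ => sup_le) bot_le fun i hi => span_le.2 ?_
  rintro _ ⟨x, hx, y, hy, rfl⟩
  exact h i (k - i) (by simp at hi; omega) x hx y hy

lemma IklS_le_Ik (l k : ℕ) : IklS K (⊤ : Submodule K R) (l + 1) k ≤ Ik K R k :=
  le_iSup (fun l => IklS K (⊤ : Submodule K R) (l + 1) k) l

lemma Ik_zero : Ik K R 0 = ⊤ :=
  top_le_iff.1 (IklS_le_Ik 0 0)

/-- An additive predicate closed under left multiplication by commutator spaces holds on `I_k`. -/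
lemma Ik_induction {P : ℕ → Submodule K R} (h₁ : ∀ k, cSp K ⊤ k ≤ P k)
    (h₂ : ∀ i j, ∀ x ∈ cSp K (⊤ : Submodule K R) i, ∀ y ∈ Ik K R j, y ∈ P j → x * y ∈ P (i + j))
    (k : ℕ) : Ik K R k ≤ P k := by
  refine iSup_le fun l => ?_
  induction l generalizing k with
  | zero => exact h₁ k
  | succ l ih =>
    refine IklS_succ_le fun i j hij x hx y hy => ?_
    subst hij
    exact h₂ i j x hx y (IklS_le_Ik l j hy) (ih j hy)

lemma cSp_mul_Ik {i j : ℕ} {x y : R} (hx : x ∈ cSp K (⊤ : Submodule K R) i)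
    (hy : y ∈ Ik K R j) : x * y ∈ Ik K R (i + j) := by
  refine iSup_induction (fun l => IklS K (⊤ : Submodule K R) (l + 1) j)
    (motive := fun y => x * y ∈ Ik K R (i + j)) hy (fun l y hy => ?_) (by simp)
    fun a b ha hb => by rw [mul_add]; exact add_mem ha hb
  exact IklS_le_Ik (l + 1) _ (mul_mem_IklS rfl hx hy)

lemma Ik_antitone : Antitone (Ik K R) := by
  refine antitone_nat_of_succ_le fun k => ?_
  suffices ∀ k, Ik K R k ≤ Ik K R (k - 1) from this (k + 1)
  refine Ik_induction (P := fun k => Ik K R (k - 1))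
    (fun k => (cSp_top_antitone (Nat.sub_le k 1)).trans (IklS_le_Ik 0 _)) ?_
  intro i j x hx y hy hy'
  rcases i with _ | i
  · simpa using cSp_mul_Ik hx hy'
  · have := cSp_mul_Ik (cSp_top_antitone (Nat.le_succ i) hx) hy
    rwa [show i + 1 + j - 1 = i + j by omega]

variable [IsScalarTower K R R]

lemma Ik_mul_Ik {i j : ℕ} {x y : R} (hx : x ∈ Ik K R i) (hy : y ∈ Ik K R j) :
    x * y ∈ Ik K R (i + j) := by
  suffices ∀ i, Ik K R i ≤ (Ik K R (i + j)).comap (LinearMap.mulRight K y) from this i hx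
  refine Ik_induction (fun i x hx => cSp_mul_Ik hx hy) fun i j' x hx z _ hz => ?_
  simp only [mem_comap, LinearMap.mulRight_apply] at hz ⊢
  rw [mul_assoc, add_assoc]
  exact cSp_mul_Ik hx hz

variable [SMulCommClass K R R]

/-- The linear map `x ↦ x * y - y * x`. -/
def commRight (y : R) : R →ₗ[K] R := LinearMap.mulRight K y - LinearMap.mulLeft K y

@[simp] lemma commRight_apply (x y : R) : commRight (K := K) y x = x * y - y * x := rfl

lemma comm_mem_cSp {i j : ℕ} {x y : R} (hx : x ∈ cSp K (⊤ : Submodule K R) i)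
    (hy : y ∈ cSp K (⊤ : Submodule K R) j) :
    x * y - y * x ∈ cSp K (⊤ : Submodule K R) (i + j + 1) := by
  induction i generalizing j x y with
  | zero => rw [zero_add]; exact mul_sub_mul_mem_cSp_succ hx hy
  | succ i ih =>
    suffices cSp K ⊤ (i + 1) ≤ (cSp K ⊤ (i + 1 + j + 1)).comap (commRight (K := K) y) from this hx
    refine cSp_succ_le fun a ha z hz => ?_
    rw [mem_comap, commRight_apply]
    have h₁ := mul_sub_mul_mem_cSp_succ ha (ih hz hy)
    have h₂ := ih hz (mul_sub_mul_mem_cSp_succ ha hy)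
    rw [show i + 1 + j + 1 = i + j + 1 + 1 by omega]
    rw [show i + (j + 1) + 1 = i + j + 1 + 1 by omega] at h₂
    convert sub_mem h₁ h₂ using 1
    noncomm_ring

lemma cSp_comm_IklS {l i j : ℕ} {x y : R} (hx : x ∈ cSp K (⊤ : Submodule K R) i)
    (hy : y ∈ IklS K (⊤ : Submodule K R) (l + 1) j) :
    x * y - y * x ∈ IklS K (⊤ : Submodule K R) (l + 1) (i + j + 1) := by
  induction l generalizing j y with
  | zero => exact comm_mem_cSp hx hy
  | succ l ih =>
    suffices IklS K ⊤ (l + 2) j ≤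
        (IklS K ⊤ (l + 2) (i + j + 1)).comap (commRight (K := K) x) by
      have := neg_mem (mem_comap.1 (this hy))
      rwa [commRight_apply, neg_sub] at this
    refine IklS_succ_le fun p q hpq z hz w hw => ?_
    rw [mem_comap, commRight_apply]
    have h₁ := mul_mem_IklS (k := i + j + 1) (by omega) (comm_mem_cSp hx hz) hw
    have h₂ := mul_mem_IklS (k := i + j + 1) (by omega) hz (ih hw)
    convert neg_mem (add_mem h₁ h₂) using 1
    noncomm_ring

lemma cSp_comm_Ik {i j : ℕ} {x y : R} (hx : x ∈ cSp K (⊤ : Submodule K R) i)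
    (hy : y ∈ Ik K R j) : x * y - y * x ∈ Ik K R (i + j + 1) := by
  suffices Ik K R j ≤ (Ik K R (i + j + 1)).comap (commRight (K := K) x) by
    have := neg_mem (mem_comap.1 (this hy))
    rwa [commRight_apply, neg_sub] at this
  refine iSup_le fun l y hy => ?_
  rw [mem_comap, commRight_apply, ← neg_sub]
  exact neg_mem (IklS_le_Ik _ _ (cSp_comm_IklS hx hy))

lemma Ik_comm_Ik {i j : ℕ} {x y : R} (hx : x ∈ Ik K R i) (hy : y ∈ Ik K R j) :
    x * y - y * x ∈ Ik K R (i + j + 1) := by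
  suffices ∀ i, Ik K R i ≤ (Ik K R (i + j + 1)).comap (commRight (K := K) y) from this i hx
  refine Ik_induction (fun i x hx => cSp_comm_Ik hx hy) fun p q z hz w hw ih => ?_
  rw [mem_comap, commRight_apply] at ih ⊢
  have h₁ := cSp_mul_Ik hz ih
  have h₂ := Ik_mul_Ik (cSp_comm_Ik hz hy) hw
  rw [show p + (q + j + 1) = p + q + j + 1 by omega] at h₁
  rw [show p + j + 1 + q = p + q + j + 1 by omega] at h₂
  convert add_mem h₁ h₂ using 1
  noncomm_ring

/-- A subspace containing `[R, I_k]` and stable under anticommutators with `R` contains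
`I_{k+1}`. -/
lemma Ik_succ_le [CharZero K] {k : ℕ} {P : Submodule K R}
    (hcomm : ∀ a, ∀ x ∈ Ik K R k, a * x - x * a ∈ P)
    (hanti : ∀ a, ∀ x ∈ P, a * x + x * a ∈ P) : Ik K R (k + 1) ≤ P := by
  refine iSup_le fun l => ?_
  induction l with
  | zero => exact cSp_succ_le fun a _ x hx => hcomm a x (IklS_le_Ik 0 k hx)
  | succ l ih =>
    refine IklS_succ_le fun i j hij x hx y hy => ?_
    induction i generalizing j x y with
    | zero =>
      obtain rfl : j = k + 1 := by omega
      have h₁ := hanti x y (ih hy)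
      have h₂ := hcomm x y (Ik_antitone (Nat.le_succ k) (IklS_le_Ik _ _ hy))
      have h₃ := P.smul_mem (2⁻¹ : K) (add_mem h₁ h₂)
      rwa [show x * y + y * x + (x * y - y * x) = (2 : K) • (x * y) by rw [two_smul]; abel,
        smul_smul, inv_mul_cancel₀ two_ne_zero, one_smul] at h₃
    | succ i ihi =>
      suffices cSp K ⊤ (i + 1) ≤ P.comap (LinearMap.mulRight K y) from this hx
      refine cSp_succ_le fun a ha z hz => ?_
      rw [mem_comap, LinearMap.mulRight_apply]
      have h₀ := cSp_mul_Ik hz (IklS_le_Ik _ _ hy)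
      rw [show i + j = k by omega] at h₀
      have h₁ := hcomm a _ h₀
      have h₂ := ihi (0 + j + 1) (by omega) z hz _ (cSp_comm_IklS (i := 0) ha hy)
      convert sub_mem h₁ h₂ using 1
      noncomm_ring

end CommutatorIdeals

section Sl2Filtration

variable {A : Type*} [Ring A]

lemma iterate_comm_mul_eq_zero (f : A) (n : ℕ) {a b : ℕ} {x y : A}
    (hx : (fun z => f * z - z * f)^[a] x = 0) (hy : (fun z => f * z - z * f)^[b] y = 0)
    (hab : a + b ≤ n + 1) : (fun z => f * z - z * f)^[n] (x * y) = 0 := by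
  have hzero : ∀ n, (fun z => f * z - z * f)^[n] 0 = 0 := fun n =>
    Function.iterate_fixed (by simp) n
  have hadd : ∀ n (u v : A), (fun z => f * z - z * f)^[n] (u + v) =
      (fun z => f * z - z * f)^[n] u + (fun z => f * z - z * f)^[n] v := fun n =>
    iterate_map_add (⟨⟨fun z => f * z - z * f, by simp⟩, fun u v => by noncomm_ring⟩ : A →+ A) n
  induction n generalizing a b x y with
  | zero =>
    rcases a with _ | a
    · obtain rfl : x = 0 := hx
      simp
    · obtain rfl : b = 0 := by omega
      obtain rfl : y = 0 := hy
      simp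
  | succ n ih =>
    rcases a with _ | a
    · obtain rfl : x = 0 := hx
      rw [zero_mul, hzero]
    rcases b with _ | b
    · obtain rfl : y = 0 := hy
      rw [mul_zero, hzero]
    rw [Function.iterate_succ_apply,
      show f * (x * y) - x * y * f = (f * x - x * f) * y + x * (f * y - y * f) by noncomm_ring,
      hadd, ih (a := a) (b := b + 1) hx hy (by omega), ih (a := a + 1) (b := b) hx hy (by omega),
      add_zero]

variable [Algebra K A]

/-- The linear map `ad f`. -/
def adMap (f : A) : A →ₗ[K] A := LinearMap.mulLeft K f - LinearMap.mulRight K f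

@[simp] lemma adMap_apply (f x : A) : adMap K f x = f * x - x * f := rfl

/-- The span of `(ad f)^r (e^j)` for `0 ≤ r ≤ 2j`. -/
def adPowSpan (e f : A) (j : ℕ) : Submodule K A :=
  span K {x | ∃ r : ℕ, r ≤ 2 * j ∧ x = (fun y => f * y - y * f)^[r] (e ^ j)}

/-- The span of `1, e, h, f`. -/
def sl2Span (e h f : A) : Submodule K A := span K {1, e, h, f}

/-- Elements `e, h, f` of an algebra satisfying the relations of the standard basis of `sl₂`. -/
structure Sl2Rel (e h f : A) : Prop where
  ef : e * f - f * e = h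
  he : h * e - e * h = 2 * e
  hf : h * f - f * h = -(2 * f)

variable {K} {e h f : A}

namespace Sl2Rel

lemma iterate_comm_pow_eq_zero (H : Sl2Rel e h f) (j : ℕ) :
    (fun z => f * z - z * f)^[2 * j + 1] (e ^ j) = 0 := by
  induction j with
  | zero => simp
  | succ j ih =>
    rw [pow_succ]
    refine iterate_comm_mul_eq_zero f _ (b := 3) ih ?_ (by omega)
    have h₁ : f * e - e * f = -h := by rw [← H.ef]; noncomm_ring
    have h₂ : f * -h - -h * f = -(2 * f) := by rw [← H.hf]; noncomm_ring
    simp only [Function.iterate_succ_apply, Function.iterate_zero, id, h₁, h₂]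
    noncomm_ring

lemma h_mul_pow (H : Sl2Rel e h f) (j : ℕ) :
    h * e ^ j = e ^ j * h + (2 * j : K) • e ^ j := by
  induction j with
  | zero => simp
  | succ j ih =>
    have h₁ : h * e = e * h + (2 : K) • e := by
      rw [two_smul, ← two_mul, ← H.he]; abel
    rw [pow_succ, ← mul_assoc, ih, add_mul, mul_assoc, h₁]
    simp only [mul_add, smul_mul_assoc, mul_smul_comm, mul_assoc]
    push_cast
    module

lemma ad_pow (H : Sl2Rel e h f) (j : ℕ) : f * e ^ (j + 1) - e ^ (j + 1) * f =
    -(j + 1 : K) • (e ^ j * h) - ((j + 1) * j : K) • e ^ j := by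
  induction j with
  | zero => simp [← H.ef]
  | succ j ih =>
    have h₁ : h * e = e * h + (2 : K) • e := by
      rw [two_smul, ← two_mul, ← H.he]; abel
    rw [show f * e ^ (j + 1 + 1) - e ^ (j + 1 + 1) * f =
      (f * e ^ (j + 1) - e ^ (j + 1) * f) * e - e ^ (j + 1) * (e * f - f * e) by
        rw [pow_succ e (j + 1)]; noncomm_ring, ih, H.ef, sub_mul, smul_mul_assoc, mul_assoc, h₁,
      smul_mul_assoc, mul_add, ← mul_assoc, ← pow_succ, mul_smul_comm, ← pow_succ]
    push_cast
    module

lemma sl2Span_comm (H : Sl2Rel e h f) {x y : A} (hx : x ∈ sl2Span K e h f)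
    (hy : y ∈ sl2Span K e h f) : x * y - y * x ∈ sl2Span K e h f := by
  have hle : ∀ z ∈ ({1, e, h, f} : Set A), z ∈ sl2Span K e h f := fun z hz => subset_span hz
  have he := hle e (by simp)
  have hh := hle h (by simp)
  have hf := hle f (by simp)
  have h₁ : e * f - f * e ∈ sl2Span K e h f := by rwa [H.ef]
  have h₂ : h * e - e * h ∈ sl2Span K e h f := by rw [H.he, two_mul]; exact add_mem he he
  have h₃ : h * f - f * h ∈ sl2Span K e h f := by
    rw [H.hf, two_mul]; exact neg_mem (add_mem hf hf)
  have h₁' := neg_mem h₁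
  have h₂' := neg_mem h₂
  have h₃' := neg_mem h₃
  rw [neg_sub] at h₁' h₂' h₃'
  suffices sl2Span K e h f ≤ (sl2Span K e h f).comap (commRight y) from this hx
  refine span_le.2 fun x hx => ?_
  suffices sl2Span K e h f ≤ (sl2Span K e h f).comap (adMap K x) from this hy
  refine span_le.2 fun y hy => ?_
  simp only [SetLike.mem_coe, mem_comap, adMap_apply]
  simp only [Set.mem_insert_iff, Set.mem_singleton_iff] at hx hy
  rcases hx with rfl | rfl | rfl | rfl <;> rcases hy with rfl | rfl | rfl | rfl <;>
    simp [*]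

end Sl2Rel

lemma one_le_sl2Span : 1 ≤ sl2Span K e h f := by
  rw [Submodule.one_le]; exact subset_span (by simp)

lemma sl2Span_pow_mono : Monotone fun n => sl2Span K e h f ^ n :=
  pow_right_mono₀ one_le_sl2Span

lemma mul_mem_sl2Span_pow {i j : ℕ} {x y : A} (hx : x ∈ sl2Span K e h f ^ i)
    (hy : y ∈ sl2Span K e h f ^ j) : x * y ∈ sl2Span K e h f ^ (i + j) := by
  rw [pow_add]; exact mul_mem_mul hx hy

namespace Sl2Rel

lemma sl2Span_comm_pow (H : Sl2Rel e h f) {j : ℕ} {x y : A} (hx : x ∈ sl2Span K e h f)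
    (hy : y ∈ sl2Span K e h f ^ j) : x * y - y * x ∈ sl2Span K e h f ^ j := by
  induction j generalizing y with
  | zero =>
    rw [pow_zero, mem_one] at hy
    obtain ⟨c, rfl⟩ := hy
    rw [Algebra.commutes, sub_self]
    exact zero_mem _
  | succ j ih =>
    suffices sl2Span K e h f ^ (j + 1) ≤ (sl2Span K e h f ^ (j + 1)).comap (adMap K x) from this hy
    rw [pow_succ', Submodule.mul_le]
    intro w hw z hz
    rw [mem_comap, adMap_apply]
    convert add_mem (mul_mem_mul (H.sl2Span_comm hx hw) hz) (mul_mem_mul hw (ih hz)) using 1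
    noncomm_ring

lemma pow_comm_pow (H : Sl2Rel e h f) {i j : ℕ} {x y : A} (hx : x ∈ sl2Span K e h f ^ (i + 1))
    (hy : y ∈ sl2Span K e h f ^ j) : x * y - y * x ∈ sl2Span K e h f ^ (i + j) := by
  induction i generalizing x with
  | zero =>
    rw [zero_add] at hx ⊢
    rw [pow_one] at hx
    exact H.sl2Span_comm_pow hx hy
  | succ i ih =>
    suffices sl2Span K e h f ^ (i + 1 + 1) ≤
      (sl2Span K e h f ^ (i + 1 + j)).comap (commRight y) from this hx
    rw [pow_succ', Submodule.mul_le]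
    intro w hw z hz
    rw [mem_comap, commRight_apply]
    have h₁ := mul_mem_sl2Span_pow (i := 1) (by rwa [pow_one]) (ih hz)
    have h₂ := mul_mem_sl2Span_pow (H.sl2Span_comm_pow hw hy) hz
    rw [show 1 + (i + j) = i + 1 + j by omega] at h₁
    rw [show j + (i + 1) = i + 1 + j by omega] at h₂
    convert add_mem h₁ h₂ using 1
    noncomm_ring

lemma adPowSpan_le (H : Sl2Rel e h f) (j : ℕ) : adPowSpan K e f j ≤ sl2Span K e h f ^ j := by
  refine span_le.2 ?_
  rintro _ ⟨r, -, rfl⟩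
  induction r with
  | zero => exact pow_mem_pow _ (subset_span (by simp)) j
  | succ r ih =>
    rw [Function.iterate_succ_apply']
    exact H.sl2Span_comm_pow (subset_span (by simp)) ih

lemma iterate_mem_adPowSpan (H : Sl2Rel e h f) (j r : ℕ) :
    (fun y => f * y - y * f)^[r] (e ^ j) ∈ adPowSpan K e f j := by
  by_cases hr : r ≤ 2 * j
  · exact subset_span ⟨r, hr, rfl⟩
  · obtain ⟨s, rfl⟩ := Nat.exists_eq_add_of_lt (not_le.1 hr)
    rw [show 2 * j + s + 1 = s + (2 * j + 1) by omega, Function.iterate_add_apply,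
      H.iterate_comm_pow_eq_zero, Function.iterate_fixed (by simp)]
    exact zero_mem _

lemma ad_mem_adPowSpan (H : Sl2Rel e h f) {j : ℕ} {x : A} (hx : x ∈ adPowSpan K e f j) :
    f * x - x * f ∈ adPowSpan K e f j := by
  suffices adPowSpan K e f j ≤ (adPowSpan K e f j).comap (adMap K f) from this hx
  refine span_le.2 ?_
  rintro _ ⟨r, -, rfl⟩
  rw [SetLike.mem_coe, mem_comap, adMap_apply]
  have := H.iterate_mem_adPowSpan (K := K) j (r + 1)
  rwa [Function.iterate_succ_apply'] at this

lemma ad_mem_sup (H : Sl2Rel e h f) {j : ℕ} {x : A}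
    (hx : x ∈ sl2Span K e h f ^ j ⊔ adPowSpan K e f (j + 1)) :
    f * x - x * f ∈ sl2Span K e h f ^ j ⊔ adPowSpan K e f (j + 1) := by
  obtain ⟨u, hu, v, hv, rfl⟩ := mem_sup.1 hx
  convert add_mem_sup (H.sl2Span_comm_pow (x := f) (subset_span (by simp)) hu) (H.ad_mem_adPowSpan hv)
    using 1
  noncomm_ring

lemma mul_adPowSpan_mem [CharZero K] (H : Sl2Rel e h f) {c : K}
    (hc : (2 : K) • (e * f + f * e) + h * h = algebraMap K A c) {j : ℕ} {w v : A}
    (hw : w ∈ sl2Span K e h f) (hv : v ∈ adPowSpan K e f j) :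
    w * v ∈ sl2Span K e h f ^ j ⊔ adPowSpan K e f (j + 1) := by
  set W := sl2Span K e h f
  have he : e ∈ W := subset_span (by simp)
  have hh : h ∈ W := subset_span (by simp)
  have hf : f ∈ W := subset_span (by simp)
  have hU : ∀ {x}, x ∈ W ^ j → x ∈ W ^ j ⊔ adPowSpan K e f (j + 1) := fun hx => mem_sup_left hx
  have hej : e ^ j ∈ W ^ j := pow_mem_pow _ he j
  have base_e : e * e ^ j ∈ W ^ j ⊔ adPowSpan K e f (j + 1) := by
    rw [← pow_succ']
    exact mem_sup_right (H.iterate_mem_adPowSpan (j + 1) 0)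
  have base_h' : e ^ j * h ∈ W ^ j ⊔ adPowSpan K e f (j + 1) := by
    have h₁ := H.ad_mem_sup base_e
    rw [← pow_succ', H.ad_pow (K := K)] at h₁
    have h₂ := add_mem h₁ (smul_mem _ ((j + 1) * j : K) (hU hej))
    rw [sub_add_cancel] at h₂
    exact (smul_mem_iff _ (neg_ne_zero.2 (Nat.cast_add_one_ne_zero j))).1 h₂
  have base_h : h * e ^ j ∈ W ^ j ⊔ adPowSpan K e f (j + 1) := by
    rw [H.h_mul_pow (K := K)]
    exact add_mem base_h' (hU (smul_mem _ _ hej))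
  have key : ∃ u ∈ W ^ j, f * (e ^ j * h) - e ^ j * h * f = (4 * j + 2 : K) • (e ^ j * f) + u := by
    have h₁ : f * h - h * f = (2 : K) • f := by
      rw [← neg_sub, H.hf, neg_neg, two_smul, two_mul]
    rcases j with _ | i
    · exact ⟨0, zero_mem _, by simpa using h₁⟩
    · refine ⟨-(i + 1 : K) • (c • e ^ i + (2 : K) • (e ^ i * h)) - ((i + 1) * i : K) • (e ^ i * h),
        ?_, ?_⟩
      · have h₂ : e ^ i ∈ W ^ i := pow_mem_pow _ he i
        have h₃ : e ^ i * h ∈ W ^ (i + 1) := mul_mem_mul h₂ hh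
        exact sub_mem (smul_mem _ _ (add_mem (smul_mem _ _ (sl2Span_pow_mono (Nat.le_succ i) h₂))
          (smul_mem _ _ h₃))) (smul_mem _ _ h₃)
      · have h₂ : h * h = c • (1 : A) - (4 : K) • (e * f) + (2 : K) • h := by
          rw [← Algebra.algebraMap_eq_smul_one, ← hc, ← H.ef]
          module
        rw [show f * (e ^ (i + 1) * h) - e ^ (i + 1) * h * f =
          (f * e ^ (i + 1) - e ^ (i + 1) * f) * h + e ^ (i + 1) * (f * h - h * f) by
            noncomm_ring, h₁, H.ad_pow (K := K), sub_mul, smul_mul_assoc, mul_assoc, h₂,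
          smul_mul_assoc, mul_smul_comm, mul_add, mul_sub, mul_smul_comm, mul_smul_comm,
          mul_smul_comm, mul_one, ← mul_assoc (e ^ i) e f, ← pow_succ]
        push_cast
        module
  have base_f : f * e ^ j ∈ W ^ j ⊔ adPowSpan K e f (j + 1) := by
    obtain ⟨u, hu, hk⟩ := key
    have h₁ := H.ad_mem_sup base_h'
    rw [hk] at h₁
    have h₂ := (add_mem_cancel_right (hU hu)).1 h₁
    have h₃ := (smul_mem_iff _ (by norm_cast : (4 * j + 2 : K) ≠ 0)).1 h₂
    have h₄ := add_mem (hU (H.sl2Span_comm_pow hf hej)) h₃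
    rwa [sub_add_cancel] at h₄
  obtain ⟨h₁, h₂, h₃⟩ : e * v ∈ W ^ j ⊔ adPowSpan K e f (j + 1) ∧ h * v ∈ W ^ j ⊔ adPowSpan K e f (j + 1) ∧
      f * v ∈ W ^ j ⊔ adPowSpan K e f (j + 1) := by
    suffices adPowSpan K e f j ≤
        (W ^ j ⊔ adPowSpan K e f (j + 1)).comap (LinearMap.mulLeft K e) ⊓
        ((W ^ j ⊔ adPowSpan K e f (j + 1)).comap (LinearMap.mulLeft K h) ⊓
        (W ^ j ⊔ adPowSpan K e f (j + 1)).comap (LinearMap.mulLeft K f)) from this hv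
    refine span_le.2 ?_
    rintro _ ⟨r, -, rfl⟩
    simp only [SetLike.mem_coe, mem_inf, mem_comap, LinearMap.mulLeft_apply]
    induction r with
    | zero => exact ⟨base_e, base_h, base_f⟩
    | succ r ih =>
      rw [Function.iterate_succ_apply']
      set v := (fun y => f * y - y * f)^[r] (e ^ j)
      obtain ⟨h₁, h₂, h₃⟩ := ih
      refine ⟨?_, ?_, ?_⟩
      · convert add_mem (H.ad_mem_sup h₁) h₂ using 1
        rw [← H.ef]; noncomm_ring
      · have h₄ : f * h - h * f = 2 * f := by rw [← neg_sub, H.hf, neg_neg]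
        convert sub_mem (H.ad_mem_sup h₂) (add_mem h₃ h₃) using 1
        rw [show f * (h * v) - h * v * f = (f * h - h * f) * v + h * (f * v - v * f) by
          noncomm_ring, h₄]
        noncomm_ring
      · convert H.ad_mem_sup h₃ using 1
        noncomm_ring
  suffices W ≤ (W ^ j ⊔ adPowSpan K e f (j + 1)).comap (LinearMap.mulRight K v) from this hw
  refine span_le.2 ?_
  rintro w (rfl | rfl | rfl | rfl)
  · simpa using hU (H.adPowSpan_le j hv)
  all_goals simpa

/-- If `ef + fe + h²/2` is a scalar, the products of `j + 1` elements of `span {1, e, h, f}` are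
spanned by the products of `j` elements together with the `(ad f)^r (e^(j+1))`. -/
lemma pow_succ_le [CharZero K] (H : Sl2Rel e h f) {c : K}
    (hc : (2 : K) • (e * f + f * e) + h * h = algebraMap K A c) (j : ℕ) :
    sl2Span K e h f ^ (j + 1) ≤ sl2Span K e h f ^ j ⊔ adPowSpan K e f (j + 1) := by
  induction j with
  | zero =>
    intro w hw
    rw [zero_add, pow_one] at hw
    have h₁ : (1 : A) ∈ adPowSpan K e f 0 := by
      rw [← pow_zero e]
      exact H.iterate_mem_adPowSpan 0 0
    rw [← mul_one w]
    exact H.mul_adPowSpan_mem hc hw h₁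
  | succ j ih =>
    rw [pow_succ', Submodule.mul_le]
    intro w hw x hx
    obtain ⟨u, hu, v, hv, rfl⟩ := mem_sup.1 (ih hx)
    rw [mul_add]
    refine add_mem (mem_sup_left ?_) (H.mul_adPowSpan_mem hc hw hv)
    rw [pow_succ']
    exact mul_mem_mul hw hu

/-- The products of at most `j` elements of `span {1, e, h, f}` are spanned by `1` and the
`(ad f)^r (e^l)` with `1 ≤ l ≤ j`. -/
lemma pow_le [CharZero K] (H : Sl2Rel e h f) {c : K}
    (hc : (2 : K) • (e * f + f * e) + h * h = algebraMap K A c) (j : ℕ) :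
    sl2Span K e h f ^ j ≤ 1 ⊔ ⨆ l ∈ Finset.Icc 1 j, adPowSpan K e f l := by
  induction j with
  | zero => simp
  | succ j ih =>
    refine (H.pow_succ_le hc j).trans (sup_le (ih.trans (sup_le_sup_left ?_ 1)) ?_)
    · exact biSup_mono fun l hl => Finset.Icc_subset_Icc_right (Nat.le_succ j) hl
    · exact le_sup_of_le_right (le_biSup (adPowSpan K e f) (by simp))

end Sl2Rel

end Sl2Filtration

section Matrices

variable {K} (m : ℕ)

lemma sum_single_castSucc (c : ℕ → K) (hc : c m = 0) :
    ∑ i : Fin m, Matrix.single i.castSucc i.castSucc (c i) =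
      Matrix.diagonal fun j : Fin (m + 1) => c j := by
  rw [← Matrix.sum_single_eq_diagonal, Fin.sum_univ_castSucc]
  simp [hc]

lemma sum_single_succ (c : ℕ → K) (hc : c 0 = 0) :
    ∑ i : Fin m, Matrix.single i.succ i.succ (c (i + 1)) =
      Matrix.diagonal fun j : Fin (m + 1) => c j := by
  rw [← Matrix.sum_single_eq_diagonal, Fin.sum_univ_succ]
  simp [hc]

lemma hMat_eq : hMat K m = Matrix.diagonal fun j : Fin (m + 1) => (m : K) - 2 * ((j : ℕ) : K) :=
  Matrix.sum_single_eq_diagonal _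

lemma eMat_mul_fMat : eMat K m * fMat K m =
    Matrix.diagonal fun j : Fin (m + 1) => ((j : ℕ) + 1 : K) * (m - (j : ℕ)) := by
  rw [← sum_single_castSucc m (fun j => ((j : K) + 1) * (m - j)) (by simp), eMat, fMat,
    Finset.sum_mul]
  refine Finset.sum_congr rfl fun i _ => ?_
  rw [Finset.mul_sum, Finset.sum_eq_single i]
  · rw [Matrix.single_mul_single_same, Nat.cast_sub i.2.le]
    push_cast
    rfl
  · intro j _ hj
    exact Matrix.single_mul_single_of_ne _ _ _ _ (by simpa using hj.symm) _
  · simp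

lemma fMat_mul_eMat : fMat K m * eMat K m =
    Matrix.diagonal fun j : Fin (m + 1) => ((j : ℕ) : K) * (m + 1 - (j : ℕ)) := by
  rw [← sum_single_succ m (fun j => (j : K) * (m + 1 - j)) (by simp), eMat, fMat,
    Finset.sum_mul]
  refine Finset.sum_congr rfl fun i _ => ?_
  rw [Finset.mul_sum, Finset.sum_eq_single i]
  · rw [Matrix.single_mul_single_same, Nat.cast_sub i.2.le]
    push_cast
    ring_nf
  · intro j _ hj
    exact Matrix.single_mul_single_of_ne _ _ _ _ (by simpa using hj.symm) _
  · simp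

lemma sl2Rel_mat : Sl2Rel (eMat K m) (hMat K m) (fMat K m) where
  ef := by
    rw [eMat_mul_fMat, fMat_mul_eMat, hMat_eq, Matrix.diagonal_sub]
    congr 1
    ext j
    ring
  he := by
    rw [hMat_eq, eMat, Finset.mul_sum, Finset.sum_mul, Finset.mul_sum, ← Finset.sum_sub_distrib]
    refine Finset.sum_congr rfl fun i _ => ?_
    ext a b
    rw [Matrix.sub_apply, Matrix.diagonal_mul, Matrix.mul_diagonal,
      two_mul (Matrix.single _ _ _), Matrix.add_apply, Matrix.single_apply]
    split_ifs with hab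
    · obtain ⟨rfl, rfl⟩ := hab
      simp
      ring
    · simp
  hf := by
    rw [hMat_eq, fMat, Finset.mul_sum, Finset.sum_mul, Finset.mul_sum, ← Finset.sum_sub_distrib,
      ← Finset.sum_neg_distrib]
    refine Finset.sum_congr rfl fun i _ => ?_
    ext a b
    rw [Matrix.sub_apply, Matrix.diagonal_mul, Matrix.mul_diagonal,
      two_mul (Matrix.single _ _ _), Matrix.neg_apply, Matrix.add_apply, Matrix.single_apply]
    split_ifs with hab
    · obtain ⟨rfl, rfl⟩ := hab
      simp
      ring
    · simp

lemma casimir_mat : (2 : K) • (eMat K m * fMat K m + fMat K m * eMat K m) + hMat K m * hMat K m =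
    algebraMap K _ ((m * (m + 2) : ℕ) : K) := by
  rw [eMat_mul_fMat, fMat_mul_eMat, hMat_eq, Matrix.diagonal_mul_diagonal, Matrix.diagonal_add,
    ← Matrix.diagonal_smul, Matrix.diagonal_add, Matrix.algebraMap_eq_diagonal]
  congr 1
  ext j
  simp
  ring

lemma eMat_pow_apply {l : ℕ} {i j : Fin (m + 1)} (hij : (i : ℕ) + l ≠ j) :
    (eMat K m ^ l) i j = 0 := by
  induction l generalizing j with
  | zero => exact Matrix.one_apply_ne fun h => hij (by simp [h])
  | succ l ih =>
    rw [pow_succ, Matrix.mul_apply]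
    refine Finset.sum_eq_zero fun a _ => ?_
    by_cases ha : (i : ℕ) + l = a
    · suffices eMat K m a j = 0 by rw [this, mul_zero]
      rw [eMat, Matrix.sum_apply]
      refine Finset.sum_eq_zero fun b _ => ?_
      refine Matrix.single_apply_of_ne _ _ _ _ _ ?_
      rintro ⟨rfl, rfl⟩
      simp at ha hij
      omega
    · rw [ih ha, zero_mul]

lemma V2_eq_bot {j : ℕ} (hj : m < j) : V2 K m j = ⊥ := by
  have h : eMat K m ^ j = 0 := by
    ext a b
    exact eMat_pow_apply m (by omega)
  rw [V2, h, span_eq_bot]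
  rintro _ ⟨r, -, rfl⟩
  exact Function.iterate_fixed (by simp) r

lemma trace_of_mem_V2 [CharZero K] {j : ℕ} (hj : j ≠ 0) {x : Matrix (Fin (m + 1)) (Fin (m + 1)) K}
    (hx : x ∈ V2 K m j) : x.trace = 0 := by
  suffices V2 K m j ≤ LinearMap.ker (Matrix.traceLinearMap (Fin (m + 1)) K K) from this hx
  refine span_le.2 ?_
  rintro _ ⟨r, -, rfl⟩
  rw [SetLike.mem_coe, LinearMap.mem_ker, Matrix.traceLinearMap_apply]
  rcases r with _ | r
  · have h₁ := congrArg (Matrix.trace (R := K)) ((sl2Rel_mat m).h_mul_pow (K := K) j)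
    rw [Matrix.trace_add, Matrix.trace_mul_comm, left_eq_add, Matrix.trace_smul,
      smul_eq_zero] at h₁
    exact h₁.resolve_left (by simpa using hj)
  · rw [Function.iterate_succ_apply', Matrix.trace_sub, Matrix.trace_mul_comm, sub_self]

lemma span_le_V2_one [CharZero K] : span K {eMat K m, hMat K m, fMat K m} ≤ V2 K m 1 := by
  have H := sl2Rel_mat (K := K) m
  have he : eMat K m ∈ V2 K m 1 := by
    have h₁ := H.iterate_mem_adPowSpan (K := K) 1 0
    rwa [Function.iterate_zero, id, pow_one] at h₁
  have hh : hMat K m ∈ V2 K m 1 := by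
    have h₁ := neg_mem (H.ad_mem_adPowSpan he)
    rwa [neg_sub, H.ef] at h₁
  have hf : (2 : K) • fMat K m ∈ V2 K m 1 := by
    have h₁ := H.ad_mem_adPowSpan hh
    rwa [← neg_sub, H.hf, neg_neg, two_mul, ← two_smul K] at h₁
  refine span_le.2 ?_
  rintro x (rfl | rfl | rfl)
  · exact he
  · exact hh
  · exact (smul_mem_iff _ two_ne_zero).1 hf

/-- Every product of at most `j` elements of `span {1, e, h, f}` is a scalar plus a traceless
element of `⨁_{1 ≤ l ≤ j} V_{2l}`. -/
lemma exists_scalar_add_mem [CharZero K] {j : ℕ} {x : Matrix (Fin (m + 1)) (Fin (m + 1)) K}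
    (hx : x ∈ sl2Span K (eMat K m) (hMat K m) (fMat K m) ^ j) :
    ∃ c : K, ∃ y ∈ ⨆ l ∈ Finset.Icc 1 j, V2 K m l, x = c • (1 : Matrix _ _ K) + y := by
  obtain ⟨a, ha, y, hy, rfl⟩ := mem_sup.1 ((sl2Rel_mat m).pow_le (casimir_mat m) j hx)
  obtain ⟨c, rfl⟩ := mem_one.1 ha
  exact ⟨c, y, hy, by rw [Algebra.algebraMap_eq_smul_one]⟩

lemma mem_iSup_V2_of_trace [CharZero K] {j : ℕ} {x : Matrix (Fin (m + 1)) (Fin (m + 1)) K}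
    (hx : x ∈ sl2Span K (eMat K m) (hMat K m) (fMat K m) ^ j) (htr : x.trace = 0) :
    x ∈ ⨆ l ∈ Finset.Icc 1 j, V2 K m l := by
  obtain ⟨c, y, hy, rfl⟩ := exists_scalar_add_mem m hx
  have h : ⨆ l ∈ Finset.Icc 1 j, V2 K m l ≤ LinearMap.ker (Matrix.traceLinearMap (Fin (m + 1)) K K) :=
    iSup₂_le fun l hl z hz => trace_of_mem_V2 m (by simp at hl; omega) hz
  have h₁ : y.trace = 0 := h hy
  rw [Matrix.trace_add, h₁, add_zero, Matrix.trace_smul, Matrix.trace_one, smul_eq_zero] at htr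
  obtain rfl := htr.resolve_right (by simp; norm_cast)
  simpa using hy

end Matrices

section CurrentLie

variable {K}
variable {F A : Type*} [NonUnitalRing F] [Module K F] [Ring A] [Algebra K A]

lemma comm_mem_bSpan (x y : F) : x * y - y * x ∈ bSpan K (⊤ : Submodule K F) ⊤ :=
  subset_span ⟨x, mem_top, y, mem_top, rfl⟩

lemma tmul_mem_tSpan {S : Submodule K F} {T : Submodule K A} {x : F} {a : A} (hx : x ∈ S)
    (ha : a ∈ T) : x ⊗ₜ[K] a ∈ tSpan K S T :=
  subset_span ⟨x, hx, a, ha, rfl⟩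

lemma tSpan_le {S : Submodule K F} {T : Submodule K A} {P : Submodule K (F ⊗[K] A)}
    (h : ∀ x ∈ S, ∀ a ∈ T, x ⊗ₜ[K] a ∈ P) : tSpan K S T ≤ P := by
  refine span_le.2 ?_
  rintro _ ⟨x, hx, a, ha, rfl⟩
  exact h x hx a ha

lemma lieGen_le {R : Type*} [NonUnitalRing R] [Module K R] {S T : Submodule K R} (hST : S ≤ T)
    (hT : ∀ x ∈ T, ∀ y ∈ T, x * y - y * x ∈ T) : lieGen K S ≤ T :=
  sInf_le ⟨hST, hT⟩

lemma le_lieGen {R : Type*} [NonUnitalRing R] [Module K R] (S : Submodule K R) :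
    S ≤ lieGen K S :=
  le_sInf fun _ hT => hT.1

lemma lieGen_comm {R : Type*} [NonUnitalRing R] [Module K R] {S : Submodule K R} {x y : R}
    (hx : x ∈ lieGen K S) (hy : y ∈ lieGen K S) : x * y - y * x ∈ lieGen K S := by
  rw [lieGen, mem_sInf] at *
  exact fun T hT => hT.2 x (hx T hT) y (hy T hT)

variable (K F) (m : ℕ)

/-- The subspace `[F,F] ⊗ 1 + Σ_{j=1}^m I_{j-1}(F) ⊗ V_{2j}` of `F ⊗ M_{m+1}(K)`. -/
def decomp : Submodule K (F ⊗[K] Matrix (Fin (m + 1)) (Fin (m + 1)) K) :=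
  tSpan K (bSpan K (⊤ : Submodule K F) ⊤)
      (span K {(1 : Matrix (Fin (m + 1)) (Fin (m + 1)) K)}) ⊔
    ⨆ j ∈ Finset.Icc 1 m, tSpan K (Ik K F (j - 1)) (V2 K m j)

variable {K F m}

lemma decomp_le {P : Submodule K (F ⊗[K] Matrix (Fin (m + 1)) (Fin (m + 1)) K)}
    (h₁ : ∀ x ∈ bSpan K (⊤ : Submodule K F) ⊤, x ⊗ₜ[K] 1 ∈ P)
    (h₂ : ∀ j, ∀ x ∈ Ik K F j, ∀ a ∈ V2 K m (j + 1), x ⊗ₜ[K] a ∈ P) :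
    decomp K F m ≤ P := by
  refine sup_le (tSpan_le fun x hx a ha => ?_) (iSup₂_le fun j hj => tSpan_le ?_)
  · obtain ⟨c, rfl⟩ := mem_span_singleton.1 ha
    rw [TensorProduct.tmul_smul]
    exact smul_mem _ _ (h₁ x hx)
  · obtain ⟨i, rfl⟩ := Nat.exists_eq_add_of_le' (Finset.mem_Icc.1 hj).1
    exact h₂ i

lemma tmul_one_mem_decomp {x : F} (hx : x ∈ bSpan K (⊤ : Submodule K F) ⊤) :
    x ⊗ₜ[K] 1 ∈ decomp K F m :=
  mem_sup_left (tmul_mem_tSpan hx (mem_span_singleton_self _))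

lemma tmul_mem_decomp {j : ℕ} {x : F} {a : Matrix (Fin (m + 1)) (Fin (m + 1)) K}
    (hx : x ∈ Ik K F j) (ha : a ∈ ⨆ l ∈ Finset.Icc 1 (j + 1), V2 K m l) :
    x ⊗ₜ[K] a ∈ decomp K F m := by
  suffices ⨆ l ∈ Finset.Icc 1 (j + 1), V2 K m l ≤
    (decomp K F m).comap (TensorProduct.mk K F _ x) from this ha
  refine iSup₂_le fun l hl a ha => ?_
  rw [mem_comap, TensorProduct.mk_apply]
  rw [Finset.mem_Icc] at hl
  rcases le_or_gt l m with hlm | hlm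
  · exact mem_sup_right (le_biSup (fun j => tSpan K (Ik K F (j - 1)) (V2 K m j))
      (Finset.mem_Icc.2 ⟨hl.1, hlm⟩) (tmul_mem_tSpan (Ik_antitone (by omega) hx) ha))
  · rw [V2_eq_bot m hlm, mem_bot] at ha
    simp [ha]

lemma tmul_mem_decomp_of_mem_pow [CharZero K] {j : ℕ} {x : F}
    {a : Matrix (Fin (m + 1)) (Fin (m + 1)) K} (hx : x ∈ Ik K F j)
    (hx' : x ∈ bSpan K (⊤ : Submodule K F) ⊤)
    (ha : a ∈ sl2Span K (eMat K m) (hMat K m) (fMat K m) ^ (j + 1)) :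
    x ⊗ₜ[K] a ∈ decomp K F m := by
  obtain ⟨c, b, hb, rfl⟩ := exists_scalar_add_mem m ha
  rw [TensorProduct.tmul_add, TensorProduct.tmul_smul]
  exact add_mem (smul_mem _ _ (tmul_one_mem_decomp hx')) (tmul_mem_decomp hx hb)

variable [SMulCommClass K F F] [IsScalarTower K F F]

lemma tmul_mem_currentLie {g : Submodule K A} (x : F) {a : A} (ha : a ∈ g) :
    x ⊗ₜ[K] a ∈ currentLie K (F := F) g :=
  le_lieGen _ (tmul_mem_tSpan mem_top ha)

lemma currentLie_comm {g : Submodule K A} {x y : F ⊗[K] A} (hx : x ∈ currentLie K g)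
    (hy : y ∈ currentLie K g) : x * y - y * x ∈ currentLie K g :=
  lieGen_comm hx hy

lemma lTensor_adMap_mul (f : A) (x y : F ⊗[K] A) :
    (adMap K f).lTensor F (x * y) =
      (adMap K f).lTensor F x * y + x * (adMap K f).lTensor F y := by
  induction x with
  | zero => simp
  | add x₁ x₂ h₁ h₂ => rw [add_mul, map_add, h₁, h₂, map_add]; noncomm_ring
  | tmul u a =>
    induction y with
    | zero => simp
    | add y₁ y₂ h₁ h₂ => rw [mul_add, map_add, h₁, h₂, map_add]; noncomm_ring
    | tmul v b =>
      simp only [Algebra.TensorProduct.tmul_mul_tmul, LinearMap.lTensor_tmul, adMap_apply,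
        ← TensorProduct.tmul_add]
      congr 1
      noncomm_ring

lemma lTensor_adMap_mem_currentLie {g : Submodule K A} {f : A}
    (hfg : ∀ a ∈ g, f * a - a * f ∈ g) {x : F ⊗[K] A} (hx : x ∈ currentLie K g) :
    (adMap K f).lTensor F x ∈ currentLie K g := by
  suffices currentLie K g ≤
      currentLie K g ⊓ (currentLie K (F := F) g).comap ((adMap K f).lTensor F) from (this hx).2
  refine lieGen_le (le_inf (le_lieGen _) (tSpan_le fun u _ a ha => ?_)) ?_
  · exact tmul_mem_currentLie u (hfg a ha)
  · rintro u ⟨hu, hu'⟩ v ⟨hv, hv'⟩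
    refine ⟨currentLie_comm hu hv, ?_⟩
    simp only [SetLike.mem_coe, mem_comap] at hu' hv' ⊢
    rw [map_sub, lTensor_adMap_mul, lTensor_adMap_mul]
    convert add_mem (currentLie_comm hu' hv) (currentLie_comm hu hv') using 1
    abel

variable {e h f : A}

lemma tmul_one_mem_currentLie {c : K} (hc₀ : c ≠ 0)
    (hc : (2 : K) • (e * f + f * e) + h * h = algebraMap K A c) {x : F}
    (hx : x ∈ bSpan K (⊤ : Submodule K F) ⊤) :
    x ⊗ₜ[K] (1 : A) ∈ currentLie K (span K {e, h, f}) := by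
  have he : e ∈ span K {e, h, f} := subset_span (by simp)
  have hh : h ∈ span K {e, h, f} := subset_span (by simp)
  have hf : f ∈ span K {e, h, f} := subset_span (by simp)
  suffices bSpan K (⊤ : Submodule K F) ⊤ ≤
    (currentLie K (span K {e, h, f})).comap ((TensorProduct.mk K F A).flip 1) from this hx
  refine span_le.2 ?_
  rintro _ ⟨a, -, b, -, rfl⟩
  change (a * b - b * a) ⊗ₜ[K] (1 : A) ∈ currentLie K _
  refine (smul_mem_iff _ hc₀).1 ?_
  rw [← TensorProduct.tmul_smul, ← Algebra.algebraMap_eq_smul_one, ← hc]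
  have h₁ := currentLie_comm (tmul_mem_currentLie a he) (tmul_mem_currentLie b hf)
  have h₂ := currentLie_comm (tmul_mem_currentLie a hf) (tmul_mem_currentLie b he)
  have h₃ := currentLie_comm (tmul_mem_currentLie a hh) (tmul_mem_currentLie b hh)
  convert add_mem (smul_mem _ (2 : K) (add_mem h₁ h₂)) h₃ using 1
  simp only [Algebra.TensorProduct.tmul_mul_tmul, TensorProduct.tmul_add, TensorProduct.sub_tmul,
    TensorProduct.tmul_smul]
  module

lemma comm_tmul_pow_mem_currentLie (y : F) {x : F} {j : ℕ}
    (hx : x ⊗ₜ[K] (e ^ j) ∈ currentLie K (F := F) (span K {e, h, f})) :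
    (y * x - x * y) ⊗ₜ[K] (e ^ (j + 1)) ∈ currentLie K (F := F) (span K {e, h, f}) := by
  have h₁ := currentLie_comm (tmul_mem_currentLie y (subset_span (by simp) : e ∈ _)) hx
  rwa [Algebra.TensorProduct.tmul_mul_tmul, Algebra.TensorProduct.tmul_mul_tmul, ← pow_succ,
    ← pow_succ', ← TensorProduct.sub_tmul] at h₁

namespace Sl2Rel

lemma span_comm_f (H : Sl2Rel e h f) {a : A} (ha : a ∈ span K {e, h, f}) :
    f * a - a * f ∈ span K {e, h, f} := by
  suffices span K {e, h, f} ≤ (span K {e, h, f}).comap (adMap K f) from this ha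
  have hh : h ∈ span K {e, h, f} := subset_span (by simp)
  have hf : f ∈ span K {e, h, f} := subset_span (by simp)
  refine span_le.2 ?_
  rintro a (rfl | rfl | rfl) <;> rw [SetLike.mem_coe, mem_comap, adMap_apply]
  · rw [← neg_sub, H.ef]
    exact neg_mem hh
  · rw [← neg_sub, H.hf, neg_neg, two_mul]
    exact add_mem hf hf
  · simp

lemma anticomm_tmul_pow_mem_currentLie [CharZero K] (H : Sl2Rel e h f) (y : F) {x : F} {j : ℕ}
    (hx : x ⊗ₜ[K] (e ^ (j + 1)) ∈ currentLie K (F := F) (span K {e, h, f})) :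
    (y * x + x * y) ⊗ₜ[K] (e ^ (j + 1)) ∈ currentLie K (F := F) (span K {e, h, f}) := by
  have h₁ := lTensor_adMap_mem_currentLie (fun a ha => H.span_comm_f ha) hx
  rw [LinearMap.lTensor_tmul, adMap_apply] at h₁
  have h₂ := currentLie_comm (tmul_mem_currentLie y (subset_span (by simp) : e ∈ _)) h₁
  have h₃ := currentLie_comm (tmul_mem_currentLie y (subset_span (by simp) : h ∈ _)) hx
  rw [H.ad_pow (K := K)] at h₂
  have hne : ((j + 1) * (j + 2) : K) ≠ 0 := by norm_cast
  refine (smul_mem_iff _ hne).1 ?_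
  convert add_mem (smul_mem _ (j + 1 : K) h₃) h₂ using 1
  have hhe := H.h_mul_pow (K := K) 1
  simp only [pow_one] at hhe
  simp only [Algebra.TensorProduct.tmul_mul_tmul, H.h_mul_pow (K := K), mul_sub, sub_mul,
    mul_smul_comm, smul_mul_assoc, ← mul_assoc, ← pow_succ']
  simp only [mul_assoc, hhe, mul_add, mul_smul_comm]
  simp only [← mul_assoc, ← pow_succ, TensorProduct.tmul_sub, TensorProduct.tmul_add,
    TensorProduct.add_tmul, TensorProduct.tmul_smul]
  push_cast
  module

lemma tmul_pow_mem_currentLie [CharZero K] (H : Sl2Rel e h f) {x : F} {j : ℕ}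
    (hx : x ∈ Ik K F j) : x ⊗ₜ[K] (e ^ (j + 1)) ∈ currentLie K (F := F) (span K {e, h, f}) := by
  suffices Ik K F j ≤ (currentLie K (span K {e, h, f})).comap
    ((TensorProduct.mk K F A).flip (e ^ (j + 1))) from this hx
  clear hx x
  induction j with
  | zero =>
    intro x _
    change x ⊗ₜ[K] (e ^ (0 + 1)) ∈ currentLie K _
    rw [zero_add, pow_one]
    exact tmul_mem_currentLie x (subset_span (by simp))
  | succ j ih =>
    exact Ik_succ_le (fun a x hx => comm_tmul_pow_mem_currentLie a (ih hx))
      fun a x hx => H.anticomm_tmul_pow_mem_currentLie a hx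

lemma tSpan_adPowSpan_le_currentLie [CharZero K] (H : Sl2Rel e h f) (j : ℕ) :
    tSpan K (Ik K F j) (adPowSpan K e f (j + 1)) ≤ currentLie K (span K {e, h, f}) := by
  refine tSpan_le fun x hx => ?_
  suffices adPowSpan K e f (j + 1) ≤
    (currentLie K (span K {e, h, f})).comap (TensorProduct.mk K F A x) from this
  refine span_le.2 ?_
  rintro _ ⟨r, -, rfl⟩
  rw [SetLike.mem_coe, mem_comap, TensorProduct.mk_apply]
  induction r with
  | zero => exact H.tmul_pow_mem_currentLie hx
  | succ r ih =>
    rw [Function.iterate_succ_apply']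
    exact lTensor_adMap_mem_currentLie (fun a ha => H.span_comm_f ha) ih

end Sl2Rel

lemma comm_tmul_mem_decomp [CharZero K] {i j : ℕ} {x y : F}
    {a b : Matrix (Fin (m + 1)) (Fin (m + 1)) K} (hx : x ∈ Ik K F i) (ha : a ∈ V2 K m (i + 1))
    (hy : y ∈ Ik K F j) (hb : b ∈ V2 K m (j + 1)) :
    x ⊗ₜ[K] a * y ⊗ₜ[K] b - y ⊗ₜ[K] b * x ⊗ₜ[K] a ∈ decomp K F m := by
  have H := sl2Rel_mat (K := K) m
  have ha' := H.adPowSpan_le (i + 1) ha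
  have hb' := H.adPowSpan_le (j + 1) hb
  have h₁ : (x * y - y * x) ⊗ₜ[K] (a * b) ∈ decomp K F m := by
    refine tmul_mem_decomp_of_mem_pow (Ik_comm_Ik hx hy) (comm_mem_bSpan x y) ?_
    rw [show i + j + 1 + 1 = i + 1 + (j + 1) by omega]
    exact mul_mem_sl2Span_pow ha' hb'
  have h₂ : (y * x) ⊗ₜ[K] (a * b - b * a) ∈ decomp K F m := by
    refine tmul_mem_decomp (add_comm j i ▸ Ik_mul_Ik hy hx) (mem_iSup_V2_of_trace m ?_ ?_)
    · exact (H.pow_comm_pow ha' hb' :)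
    · rw [Matrix.trace_sub, Matrix.trace_mul_comm, sub_self]
  convert add_mem h₁ h₂ using 1
  rw [Algebra.TensorProduct.tmul_mul_tmul, Algebra.TensorProduct.tmul_mul_tmul,
    TensorProduct.sub_tmul, TensorProduct.tmul_sub]
  abel

lemma one_comm_tmul_mem_decomp {j : ℕ} {x y : F} {b : Matrix (Fin (m + 1)) (Fin (m + 1)) K}
    (hy : y ∈ Ik K F j) (hb : b ∈ V2 K m (j + 1)) :
    x ⊗ₜ[K] 1 * y ⊗ₜ[K] b - y ⊗ₜ[K] b * x ⊗ₜ[K] 1 ∈ decomp K F m := by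
  rw [Algebra.TensorProduct.tmul_mul_tmul, Algebra.TensorProduct.tmul_mul_tmul, one_mul, mul_one,
    ← TensorProduct.sub_tmul]
  have h₁ : x * y - y * x ∈ Ik K F j :=
    Ik_antitone (Nat.le_add_left j 0 |>.trans (Nat.le_succ _)) (cSp_comm_Ik (i := 0) mem_top hy)
  exact tmul_mem_decomp h₁ (le_biSup (V2 K m) (by simp) hb)

lemma decomp_comm [CharZero K] {z w : F ⊗[K] Matrix (Fin (m + 1)) (Fin (m + 1)) K}
    (hz : z ∈ decomp K F m) (hw : w ∈ decomp K F m) : z * w - w * z ∈ decomp K F m := by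
  suffices decomp K F m ≤ (decomp K F m).comap (commRight w) from this hz
  refine decomp_le (fun x hx => ?_) fun i x hx a ha => ?_ <;>
    rw [mem_comap, commRight_apply, ← neg_sub, neg_mem_iff]
  · suffices decomp K F m ≤ (decomp K F m).comap (commRight (x ⊗ₜ[K] 1)) from this hw
    refine decomp_le (fun y hy => ?_) fun j y hy b hb => ?_ <;> rw [mem_comap, commRight_apply]
    · rw [Algebra.TensorProduct.tmul_mul_tmul, Algebra.TensorProduct.tmul_mul_tmul, one_mul,
        ← TensorProduct.sub_tmul]
      exact tmul_one_mem_decomp (comm_mem_bSpan y x)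
    · rw [← neg_sub, neg_mem_iff]
      exact one_comm_tmul_mem_decomp hy hb
  · suffices decomp K F m ≤ (decomp K F m).comap (commRight (x ⊗ₜ[K] a)) from this hw
    refine decomp_le (fun y hy => ?_) fun j y hy b hb => ?_ <;> rw [mem_comap, commRight_apply]
    · exact one_comm_tmul_mem_decomp hx ha
    · exact comm_tmul_mem_decomp hy hb hx ha

end CurrentLie

/-- for `g = span{e,h,f} ⊆ A = M_{m+1}(k)` (the irreducible
`(m+1)`-dimensional representation of `sl₂(k)`),
`(g,A)(F) = [F,F] ⊗ 1 + Σ_{j=1}^{m} I_{j-1}(F) ⊗ V_{2j}`. -/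
theorem statement17 {K : Type*} [Field K] [CharZero K]
    {Fa : Type*} [NonUnitalRing Fa] [Module K Fa] [SMulCommClass K Fa Fa]
    [IsScalarTower K Fa Fa]
    (m : ℕ) (hm : 1 ≤ m) :
    currentLie K (F := Fa) (Submodule.span K {eMat K m, hMat K m, fMat K m}) =
      tSpan K (bSpan K (⊤ : Submodule K Fa) ⊤)
          (Submodule.span K {(1 : Matrix (Fin (m + 1)) (Fin (m + 1)) K)}) ⊔
        ⨆ j ∈ Finset.Icc 1 m, tSpan K (Ik K Fa (j - 1)) (V2 K m j) := by
  have H := sl2Rel_mat (K := K) m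
  change _ = decomp K Fa m
  refine le_antisymm (lieGen_le (tSpan_le fun x _ a ha => ?_) fun z hz w hw => decomp_comm hz hw)
    (decomp_le (fun x hx => ?_) fun j x hx a ha => ?_)
  · exact tmul_mem_decomp (j := 0) (Ik_zero (K := K) (R := Fa) ▸ mem_top)
      (le_biSup (V2 K m) (by simp) (span_le_V2_one m ha))
  · exact tmul_one_mem_currentLie (Nat.cast_ne_zero.2 (by positivity)) (casimir_mat m) hx
  · exact H.tSpan_adPowSpan_le_currentLie j (tmul_mem_tSpan hx ha)
end
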